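/- Let n ≥ 4 and 2 ≤ p ≤ log₂ n. Then 4n − 4 ≤ H'_α(ℓ_p^n) < 2^n; in particular there is no set of 2^n points on the unit sphere of ℓ_p^n that is a bounded and separated antipodal set with constant d > 1. -/

import Mathlib

open Metric

noncomputable section


/-- `S` is a bounded and separated antipodal subset of `X` with constant `d`. -/
def IsBSA {X : Type*} [NormedAddCommGroup X] [NormedSpace ℝ X] (S : Set X) (d : ℝ) : Prop :=
  S ⊆ closedBall (0 : X) 1 ∧
    ∀ x ∈ S, ∀ y ∈ S, x ≠ y → ∃ f : X →L[ℝ] ℝ, ‖f‖ ≤ 1 ∧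
      d ≤ f x - f y ∧ ∀ z ∈ S, f y ≤ f z ∧ f z ≤ f x

/-- The strict antipodality condition (with gap `> 1`). -/
def StrictAntipProp {X : Type*} [NormedAddCommGroup X] [NormedSpace ℝ X] (S : Set X) : Prop :=
  ∀ x ∈ S, ∀ y ∈ S, x ≠ y → ∃ f : X →L[ℝ] ℝ, ‖f‖ ≤ 1 ∧
    1 < f x - f y ∧ ∀ z ∈ S, f y ≤ f z ∧ f z ≤ f x

/-- The strict antipodal Hadwiger number `H'_α(X)`. -/
def strictHalpha (X : Type*) [NormedAddCommGroup X] [NormedSpace ℝ X] : ℕ :=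
  sSup {k : ℕ | ∃ S : Finset X, S.card = k ∧ (S : Set X) ⊆ sphere (0 : X) 1 ∧
    StrictAntipProp (S : Set X)}




def Antip {E : Type*} [AddCommGroup E] [Module ℝ E] (S : Finset E) : Prop :=
  ∀ x ∈ S, ∀ y ∈ S, x ≠ y → ∃ f : E →ₗ[ℝ] ℝ, f y < f x ∧ ∀ z ∈ S, f y ≤ f z ∧ f z ≤ f x

def Corner {k : ℕ} (c : Fin k → ℝ) : Prop := ∀ i, c i = 0 ∨ c i = 1

section cube
variable {E : Type*} [AddCommGroup E] [Module ℝ E]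

lemma hull_bound (S : Finset E) (K : Set E)
    (hb : ∀ φ : E →ₗ[ℝ] ℝ, ∃ m, ∀ u ∈ K, m ≤ φ u)
    (hcov : ∀ u ∈ K, ∃ x ∈ S, ∃ k ∈ K, (2:ℝ) • u = x + k)
    (φ : E →ₗ[ℝ] ℝ) (c : ℝ) (hc : ∀ x ∈ S, c ≤ φ x) : ∀ u ∈ K, c ≤ φ u := by
  intro u hu
  obtain ⟨m, hm⟩ := hb φ
  have hbd : BddBelow (φ '' K) := ⟨m, by rintro _ ⟨v, hv, rfl⟩; exact hm v hv⟩
  have hne : (φ '' K).Nonempty := ⟨_, u, hu, rfl⟩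
  have h1 : (c + sInf (φ '' K)) / 2 ≤ sInf (φ '' K) := by
    apply le_csInf hne
    rintro _ ⟨v, hv, rfl⟩
    obtain ⟨x, hx, k, hk, e⟩ := hcov v hv
    have e2 := congrArg φ e
    simp only [map_smul, map_add, smul_eq_mul] at e2
    have := hc x hx
    have := csInf_le hbd ⟨k, hk, rfl⟩
    linarith
  have := csInf_le hbd ⟨u, hu, rfl⟩
  linarith

lemma finite_gap {α : Type*} (S : Finset α) (h : α → ℝ) :
    ∃ δ > 0, ∀ x ∈ S, 0 < h x → δ ≤ h x := by
  classical
  induction S using Finset.induction_on with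
  | empty => exact ⟨1, one_pos, by simp⟩
  | insert a s _ ih =>
    obtain ⟨δ, hδ, H⟩ := ih
    by_cases ha : 0 < h a
    · refine ⟨min δ (h a), lt_min hδ ha, ?_⟩
      intro x hx hp
      rcases Finset.mem_insert.1 hx with rfl | hx
      · exact min_le_right _ _
      · exact (min_le_left _ _).trans (H x hx hp)
    · refine ⟨δ, hδ, ?_⟩
      intro x hx hp
      rcases Finset.mem_insert.1 hx with rfl | hx
      · exact absurd hp ha
      · exact H x hx hp

/-- an antipodal set in a filled cube, containing the corners, is the set of corners -/
lemma cube_contain (S : Finset E) (hS : Antip S) {k : ℕ} (a : E) (v : Fin k → E)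
    (h1 : ∀ c, Corner c → a + ∑ i, c i • v i ∈ S) (y : E) (hy : y ∈ S) (c : Fin k → ℝ)
    (hc : ∀ i, 0 ≤ c i ∧ c i ≤ 1) (hyc : y = a + ∑ i, c i • v i) :
    ∃ c, Corner c ∧ y = a + ∑ i, c i • v i := by
  classical
  let l : Fin k → ℝ := fun i => if c i = 0 then 0 else 1
  have hl : Corner l := by
    intro i; by_cases h : c i = 0 <;> simp [l, h]
  refine ⟨l, hl, ?_⟩
  by_contra hne
  obtain ⟨φ, hlt, hφ⟩ := hS y hy _ (h1 l hl) hne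
  let j : Fin k → ℝ := fun i => if 0 < φ (v i) then 1 else 0
  have hj : Corner j := by
    intro i; by_cases h : 0 < φ (v i) <;> simp [j, h]
  have h2 := (hφ _ (h1 j hj)).2
  rw [hyc] at h2 hlt
  simp only [map_add, map_sum, map_smul, smul_eq_mul, add_le_add_iff_left, add_lt_add_iff_left]
    at h2 hlt
  have h3 : ∀ i ∈ Finset.univ, c i * φ (v i) ≤ j i * φ (v i) := by
    intro i _
    by_cases h : 0 < φ (v i)
    · simp only [j, h, if_true]; nlinarith [hc i]
    · simp only [j, h, if_false]; nlinarith [hc i]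
  have h4 := (Finset.sum_eq_sum_iff_of_le h3).1 (le_antisymm (Finset.sum_le_sum h3) h2)
  refine hlt.ne (Finset.sum_congr rfl ?_)
  intro i hi
  have h5 := h4 i hi
  by_cases hc0 : c i = 0
  · simp [l, hc0]
  · simp only [l, hc0, if_false]
    by_cases h : 0 < φ (v i)
    · simp only [j, h, if_true] at h5; exact h5.symm
    · simp only [j, h, if_false, zero_mul, mul_eq_zero, hc0, false_or] at h5
      simp [h5]

lemma filled_cube (K : Set E) (hK : Convex ℝ K) {k : ℕ} (a : E) (v : Fin k → E)
    (h1 : ∀ c, Corner c → a + ∑ i, c i • v i ∈ K) (c : Fin k → ℝ)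
    (hc : ∀ i, 0 ≤ c i ∧ c i ≤ 1) : a + ∑ i, c i • v i ∈ K := by
  classical
  suffices H : ∀ T : Finset (Fin k), ∀ c : Fin k → ℝ, (∀ i, 0 ≤ c i ∧ c i ≤ 1) →
      (∀ i, i ∉ T → c i = 0 ∨ c i = 1) → a + ∑ i, c i • v i ∈ K from
    H Finset.univ c hc (by simp)
  intro T
  induction T using Finset.induction_on with
  | empty => intro c _ h; exact h1 c (fun i => h i (by simp))
  | insert i T hi ih =>
    intro c hc h
    have key : ∀ s : ℝ, s = 0 ∨ s = 1 → a + ∑ j, (Function.update c i s) j • v j ∈ K := by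
      intro s hs
      apply ih
      · intro j
        by_cases hj : j = i
        · subst hj; rcases hs with rfl | rfl <;> simp
        · simp [hj, hc j]
      · intro j hjT
        by_cases hj : j = i
        · subst hj; simpa using hs
        · simpa [hj] using h j (by simp [hj, hjT])
    have e := hK (key 0 (Or.inl rfl)) (key 1 (Or.inr rfl)) (a := 1 - c i) (b := c i)
      (by linarith [hc i]) (hc i).1 (by ring)
    convert e using 1
    rw [smul_add, smul_add, Finset.smul_sum, Finset.smul_sum]
    have : (1 - c i) • a + ∑ x, (1 - c i) • Function.update c i 0 x • v x +
      (c i • a + ∑ x, c i • Function.update c i 1 x • v x) = ((1 - c i) • a + c i • a) +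
      ((∑ x, (1 - c i) • Function.update c i 0 x • v x) + 
        ∑ x, c i • Function.update c i 1 x • v x) := by abel
    rw [this, ← add_smul, ← Finset.sum_add_distrib]
    simp only [sub_add_cancel, one_smul, add_right_inj]
    apply Finset.sum_congr rfl
    intro j _
    by_cases hj : j = i
    · subst hj; simp
    · simp only [Function.update_of_ne hj, smul_smul, ← add_smul]; congr 1; ring

lemma max_face (S : Finset E) (hS : Antip S) (h2 : 1 < S.card) :
    ∃ (f : E →ₗ[ℝ] ℝ) (r : ℝ), (∀ x ∈ S, r ≤ f x) ∧ (∃ x ∈ S, f x = r) ∧ (∃ x ∈ S, r < f x) ∧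
      ∀ (g : E →ₗ[ℝ] ℝ) (ρ : ℝ), (∀ x ∈ S, f x = r → g x = ρ) →
        ∃ t, ∀ y ∈ S, g y - ρ = t * (f y - r) := by
  classical
  let P : Finset (Finset E) := S.powerset.filter fun F =>
    ∃ (f : E →ₗ[ℝ] ℝ) (r : ℝ), (∀ x ∈ S, r ≤ f x) ∧ (∃ x ∈ S, f x = r) ∧ (∃ x ∈ S, r < f x) ∧
      F = S.filter fun x => f x = r
  have hP : P.Nonempty := by
    obtain ⟨x, hx, y, hy, hxy⟩ := Finset.one_lt_card.1 h2
    obtain ⟨f, hlt, hf⟩ := hS x hx y hy hxy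
    exact ⟨S.filter fun x => f x = f y, Finset.mem_filter.2 ⟨by simp, f, f y,
      fun z hz => (hf z hz).1, ⟨y, hy, rfl⟩, ⟨x, hx, hlt⟩, rfl⟩⟩
  obtain ⟨F, hF, hmax⟩ := Finset.exists_max_image P Finset.card hP
  obtain ⟨_, f, r, hr, hex, hgt, rfl⟩ := Finset.mem_filter.1 hF
  refine ⟨f, r, hr, hex, hgt, ?_⟩
  intro g ρ hg
  have hne : (S.filter fun x => r < f x).Nonempty := by
    obtain ⟨x, hx, h⟩ := hgt; exact ⟨x, by simp [hx, h]⟩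
  obtain ⟨y, hy, hmin⟩ := Finset.exists_min_image (S.filter fun x => r < f x)
    (fun y => (g y - ρ) / (f y - r)) hne
  obtain ⟨hyS, hyr⟩ := Finset.mem_filter.1 hy
  refine ⟨(g y - ρ) / (f y - r), ?_⟩
  set t := (g y - ρ) / (f y - r) with ht
  have hyt : g y - ρ = t * (f y - r) := by
    rw [ht, div_mul_cancel₀]; exact (sub_pos.2 hyr).ne'
  have hge : ∀ x ∈ S, t * (f x - r) ≤ g x - ρ := by
    intro x hx
    rcases (hr x hx).eq_or_lt with h | h
    · rw [hg x hx h.symm, ← h]; simp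
    · have := hmin x (by simp [hx, h])
      rwa [le_div_iff₀ (sub_pos.2 h)] at this
  by_contra hcon
  push Not at hcon
  obtain ⟨z, hz, hzne⟩ := hcon
  have hmem : (S.filter fun x => (g - t • f) x = ρ - t * r) ∈ P := by
    refine Finset.mem_filter.2 ⟨by simp, g - t • f, ρ - t * r, ?_, ⟨y, hyS, ?_⟩, ⟨z, hz, ?_⟩, rfl⟩
    · intro x hx; have := hge x hx; simp; linarith
    · simp; linarith
    · have := lt_of_le_of_ne (hge z hz) (Ne.symm hzne); simp; linarith
  have hcard := hmax _ hmem
  refine absurd hcard (not_le.2 (Finset.card_lt_card ?_))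
  rw [Finset.ssubset_iff_of_subset]
  · refine ⟨y, ?_, ?_⟩
    · simp [hyS]; linarith
    · simp [hyr.ne']
  · intro x hx
    obtain ⟨hxS, hxr⟩ := Finset.mem_filter.1 hx
    simp [hxS, hg x hxS hxr, hxr]
end cube


section cube
variable {E : Type*} [AddCommGroup E] [Module ℝ E]

/-- coordinates on `S` coming from a maximal face which is a cube -/
lemma face_coords (S : Finset E) (hS : Antip S) (f : E →ₗ[ℝ] ℝ) (r : ℝ)
    (hgt : ∃ x ∈ S, r < f x)
    (hmax : ∀ (g : E →ₗ[ℝ] ℝ) (ρ : ℝ), (∀ x ∈ S, f x = r → g x = ρ) →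
        ∃ t, ∀ y ∈ S, g y - ρ = t * (f y - r))
    {k : ℕ} (a : E) (v : Fin k → E) (hv : ∀ i, v i ≠ 0)
    (hF : ∀ y, (y ∈ S ∧ f y = r) ↔ ∃ c, Corner c ∧ y = a + ∑ i, c i • v i) :
    f a = r ∧ (∀ i, f (v i) = 0) ∧ ∃ (g : Fin k → E →ₗ[ℝ] ℝ) (w : E),
      (∀ i, g i (v i) = 1) ∧ (∀ i j, i ≠ j → g i (v j) = 0) ∧
      (∀ i, ∀ z ∈ S, 0 ≤ g i (z - a) ∧ g i (z - a) ≤ 1) ∧ f w = 1 ∧ (∀ i, g i w = 0) ∧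
      ∀ y ∈ S, y = a + ∑ i, g i (y - a) • v i + f (y - a) • w := by
  classical
  have ha : a ∈ S ∧ f a = r := (hF a).2 ⟨0, fun i => Or.inl rfl, by simp⟩
  have hav : ∀ i, a + v i ∈ S ∧ f (a + v i) = r := by
    intro i
    refine (hF _).2 ⟨Pi.single i 1, ?_, ?_⟩
    · intro j; by_cases h : j = i
      · subst h; simp
      · simp [h]
    · simp [Pi.single_apply]
  have havv : ∀ i j, i ≠ j → a + v i + v j ∈ S := by
    intro i j hij
    refine ((hF _).2 ⟨Pi.single i 1 + Pi.single j 1, ?_, ?_⟩).1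
    · intro l; by_cases h : l = i
      · subst h; simp [hij]
      · by_cases h' : l = j
        · subst h'; simp [h]
        · simp [h, h']
    · simp [Pi.single_apply, add_smul, Finset.sum_add_distrib, add_assoc]
  have hfv : ∀ i, f (v i) = 0 := by
    intro i; have := (hav i).2; rw [map_add, ha.2] at this; linarith
  have hg : ∀ i, ∃ g : E →ₗ[ℝ] ℝ, g (v i) = 1 ∧ (∀ j, i ≠ j → g (v j) = 0) ∧
      ∀ z ∈ S, 0 ≤ g (z - a) ∧ g (z - a) ≤ 1 := by
    intro i
    obtain ⟨φ, hlt, hφ⟩ := hS (a + v i) (hav i).1 a ha.1 (by simpa using hv i)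
    have hpos : 0 < φ (v i) := by simpa using hlt
    refine ⟨(φ (v i))⁻¹ • φ, ?_, ?_, ?_⟩
    · simp [hpos.ne']
    · intro j hij
      have h1 := (hφ _ (hav j).1).1
      have h2 := (hφ _ (havv i j hij)).2
      simp only [map_add] at h1 h2
      have : φ (v j) = 0 := by linarith
      simp [this]
    · intro z hz
      obtain ⟨h1, h2⟩ := hφ z hz
      simp only [map_add] at h2
      rw [LinearMap.smul_apply, smul_eq_mul, map_sub]
      constructor
      · exact mul_nonneg (inv_nonneg.2 hpos.le) (by linarith)
      · rw [inv_mul_le_iff₀ hpos]; linarith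
  choose g hg1 hg2 hg3 using hg
  refine ⟨ha.2, hfv, g, ?_⟩
  obtain ⟨y0, hy0, hy0r⟩ := hgt
  have hp : 0 < f y0 - r := sub_pos.2 hy0r
  set w : E := (f y0 - r)⁻¹ • (y0 - a - ∑ i, g i (y0 - a) • v i) with hw
  refine ⟨w, hg1, hg2, hg3, ?_, ?_, ?_⟩
  · simp [hw, hfv, ha.2, hp.ne']
  · intro i
    have : ∀ c : Fin k → ℝ, ∑ j, c j * g i (v j) = c i := by
      intro c
      rw [Finset.sum_eq_single i]
      · rw [hg1, mul_one]
      · intro j _ hj; rw [hg2 i j hj.symm, mul_zero]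
      · simp
    rw [hw, map_smul, map_sub, map_sum]
    simp only [map_smul, smul_eq_mul]
    rw [this]; simp
  · intro y hy
    rw [← sub_eq_zero, ← Module.forall_dual_apply_eq_zero_iff ℝ]
    intro φ
    obtain ⟨t, ht⟩ := hmax (φ - ∑ i, φ (v i) • g i) ((φ - ∑ i, φ (v i) • g i) a) (by
      intro x hx hxr
      obtain ⟨c, -, rfl⟩ := (hF x).1 ⟨hx, hxr⟩
      rw [map_add, map_sum, add_eq_left]
      apply Finset.sum_eq_zero
      intro j _
      rw [map_smul, smul_eq_mul, mul_eq_zero]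
      right
      simp only [LinearMap.sub_apply, LinearMap.sum_apply, LinearMap.smul_apply, smul_eq_mul]
      rw [Finset.sum_eq_single j]
      · rw [hg1]; ring
      · intro i _ hi; rw [hg2 i j hi, mul_zero]
      · simp)
    have key : ∀ y ∈ S, φ (y - a) - ∑ i, g i (y - a) * φ (v i) = t * (f y - r) := by
      intro y hy
      rw [← ht y hy, ← map_sub]
      simp only [LinearMap.sub_apply, LinearMap.sum_apply, LinearMap.smul_apply, smul_eq_mul]
      congr 1
      exact Finset.sum_congr rfl fun i _ => mul_comm _ _
    have hφw : φ w = t := by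
      rw [hw, map_smul, map_sub, map_sum]
      simp only [map_smul, smul_eq_mul]
      rw [key y0 hy0]; field_simp
    have k1 := key y hy
    have e1 : f (y - a) = f y - r := by rw [map_sub, ha.2]
    rw [e1]
    have e2 : φ (y - (a + ∑ i, g i (y - a) • v i + (f y - r) • w)) =
      φ (y - a) - ∑ i, g i (y - a) * φ (v i) - (f y - r) * φ w := by
      simp only [map_sub φ, map_add φ, map_sum φ, map_smul φ, smul_eq_mul]; ring
    rw [e2, k1, hφw]; ring

/-- every corner of the face has a vertical neighbour -/
lemma vertical (S : Finset E) (f : E →ₗ[ℝ] ℝ) (r : ℝ) (hr : ∀ x ∈ S, r ≤ f x)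
    (hgt : ∃ x ∈ S, r < f x)
    {k : ℕ} (a : E) (v : Fin k → E)
    (hF : ∀ y, (y ∈ S ∧ f y = r) ↔ ∃ c, Corner c ∧ y = a + ∑ i, c i • v i)
    (K : Set E) (hK : Convex ℝ K) (hSK : ∀ x ∈ S, x ∈ K)
    (hb : ∀ φ : E →ₗ[ℝ] ℝ, ∃ m, ∀ u ∈ K, m ≤ φ u)
    (hcov : ∀ u ∈ K, ∃ x ∈ S, ∃ k ∈ K, (2:ℝ) • u = x + k)
    (hfa : f a = r) (hfv : ∀ i, f (v i) = 0) (g : Fin k → E →ₗ[ℝ] ℝ) (w : E)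
    (hg1 : ∀ i, g i (v i) = 1) (hg2 : ∀ i j, i ≠ j → g i (v j) = 0)
    (hg3 : ∀ i, ∀ z ∈ S, 0 ≤ g i (z - a) ∧ g i (z - a) ≤ 1) (hfw : f w = 1)
    (hgw : ∀ i, g i w = 0)
    (hrep : ∀ y ∈ S, y = a + ∑ i, g i (y - a) • v i + f (y - a) • w)
    (j : Fin k → ℝ) (hj : Corner j) :
    ∃ τ : ℝ, 0 < τ ∧ a + ∑ i, j i • v i + τ • w ∈ S := by
  classical
  by_contra hcon
  push Not at hcon
  have hf0 : ∀ x ∈ S, 0 ≤ f (x - a) := by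
    intro x hx; rw [map_sub, hfa]; linarith [hr x hx]
  have hgK : ∀ i, ∀ z ∈ K, 0 ≤ g i (z - a) ∧ g i (z - a) ≤ 1 := by
    intro i z hz
    constructor
    · have := hull_bound S K hb hcov (g i) (g i a)
        (fun x hx => by have := (hg3 i x hx).1; rw [map_sub] at this; linarith) z hz
      rw [map_sub]; linarith
    · have := hull_bound S K hb hcov (-g i) (-(1 + g i a))
        (fun x hx => by
          have := (hg3 i x hx).2; rw [map_sub] at this; rw [LinearMap.neg_apply]; linarith) z hz
      rw [LinearMap.neg_apply] at this
      rw [map_sub]; linarith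
  have hfK : ∀ z ∈ K, 0 ≤ f (z - a) := by
    intro z hz
    have := hull_bound S K hb hcov f r hr z hz
    rw [map_sub, hfa]; linarith
  have hgsum : ∀ (c : Fin k → ℝ) (t : ℝ) i, g i (∑ j, c j • v j + t • w) = c i := by
    intro c t i
    rw [map_add, map_smul, hgw, map_sum]
    simp only [map_smul, smul_eq_mul]
    rw [Finset.sum_eq_single i]
    · rw [hg1]; ring
    · intro j _ hj; rw [hg2 i j hj.symm, mul_zero]
    · simp
  have hfsum : ∀ (c : Fin k → ℝ) (t : ℝ), f (∑ j, c j • v j + t • w) = t := by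
    intro c t; simp [hfv, hfw]
  -- gap
  obtain ⟨δ, hδ, hgap⟩ := finite_gap S (fun x => f (x - a))
  let ψ : E → ℝ := fun z => ∑ i, (1 - 2 * j i) * (g i (z - a) - j i)
  have hψ0 : ∀ z ∈ S, ∀ i, 0 ≤ (1 - 2 * j i) * (g i (z - a) - j i) := by
    intro z hz i
    have := hg3 i z hz
    rcases hj i with h | h <;> rw [h] <;> linarith
  have hψpos : ∀ z ∈ S, 0 < f (z - a) → 0 < ψ z := by
    intro z hz hfz
    refine lt_of_le_of_ne (Finset.sum_nonneg fun i _ => hψ0 z hz i) ?_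
    intro h0
    have h1 := (Finset.sum_eq_zero_iff_of_nonneg (fun i _ => hψ0 z hz i)).1 h0.symm
    refine hcon _ hfz ?_
    have : ∀ i, g i (z - a) = j i := by
      intro i
      have := h1 i (Finset.mem_univ i)
      rcases hj i with h | h <;> rw [h] at this ⊢ <;> linarith
    have e := hrep z hz
    simp only [this] at e
    rw [← e]; exact hz
  obtain ⟨ε, hε, hεψ⟩ := finite_gap S (fun x => ψ x / f (x - a))
  have hψf : ∀ z ∈ S, ε * f (z - a) ≤ ψ z := by
    intro z hz
    rcases (hf0 z hz).eq_or_lt with h | h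
    · rw [← h, mul_zero]; exact Finset.sum_nonneg fun i _ => hψ0 z hz i
    · have := hεψ z hz (div_pos (hψpos z hz h) h)
      rwa [le_div_iff₀ h] at this
  have hψK : ∀ z ∈ K, ε * f (z - a) ≤ ψ z := by
    let Ψ : E →ₗ[ℝ] ℝ := ∑ i, (1 - 2 * j i) • g i - ε • f
    have hΨ : ∀ z, Ψ z = ψ z - ε * f (z - a) + (Ψ a + ∑ i, (1 - 2 * j i) * j i) := by
      intro z
      simp only [Ψ, ψ, LinearMap.sub_apply, LinearMap.sum_apply, LinearMap.smul_apply,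
        smul_eq_mul, map_sub, mul_sub, Finset.sum_sub_distrib]
      ring
    intro z hz
    have := hull_bound S K hb hcov Ψ (Ψ a + ∑ i, (1 - 2 * j i) * j i)
      (fun x hx => by rw [hΨ x]; linarith [hψf x hx]) z hz
    rw [hΨ z] at this
    linarith
  obtain ⟨y0, hy0, hy0r⟩ := hgt
  set h0 := f (y0 - a) with hh0
  have hh0p : 0 < h0 := by rw [hh0, map_sub, hfa]; linarith
  obtain ⟨s, hs0, hs4, hsδ⟩ : ∃ s : ℝ, 0 < s ∧ s ≤ 1/4 ∧ 2 * (s * h0) < δ := by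
    refine ⟨min (1/4) (δ / (4 * h0)), by positivity, min_le_left _ _, ?_⟩
    have : min (1/4) (δ / (4 * h0)) * h0 ≤ δ / (4 * h0) * h0 := by gcongr; exact min_le_right _ _
    have e : δ / (4 * h0) * h0 = δ / 4 := by field_simp
    linarith
  set t := s * h0 with ht
  have htp : 0 < t := by positivity
  obtain ⟨η, hη0, hη2, hηk⟩ : ∃ η : ℝ, 0 < η ∧ η ≤ 1/2 ∧ k * η < ε * (2 * t) := by
    refine ⟨min (1/2) (ε * t / (k + 1)), by positivity, min_le_left _ _, ?_⟩
    have h1 : (k:ℝ) * min (1/2) (ε * t / (k + 1)) ≤ (k + 1) * (ε * t / (k + 1)) := by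
      gcongr
      · linarith
      · exact min_le_right _ _
    have e : ((k:ℝ) + 1) * (ε * t / (k + 1)) = ε * t := by field_simp
    have : 0 < ε * t := by positivity
    linarith
  let c : Fin k → ℝ := fun i => 1/2 + η * (1 - 2 * j i) / 2
  have hc : ∀ i, 1/4 ≤ c i ∧ c i ≤ 3/4 := by
    intro i
    rcases hj i with h | h <;> simp only [c, h] <;> constructor <;> linarith
  have hu : a + (∑ i, c i • v i + t • w) ∈ K := by
    have h1 := filled_cube K hK a v (fun c hc => hSK _ ((hF _).2 ⟨c, hc, rfl⟩).1)
      (fun i => (c i - s * g i (y0 - a)) / (1 - s)) (by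
        intro i
        have h1 := hg3 i y0 hy0
        have h2 := hc i
        have hpos : 0 < 1 - s := by linarith
        constructor
        · apply div_nonneg _ hpos.le
          nlinarith
        · rw [div_le_one hpos]
          nlinarith)
    have h2 := hK h1 (hSK y0 hy0) (a := 1 - s) (b := s) (by linarith) hs0.le (by ring)
    convert h2 using 1
    have e2 : s • y0 = s • (a + ∑ i, g i (y0 - a) • v i + h0 • w) :=
      congrArg (fun z => s • z) (hrep y0 hy0)
    rw [e2]
    have hpos : (1 - s) ≠ 0 := by linarith
    have e : ∀ i, c i • v i = (1 - s) • (((c i - s * g i (y0 - a)) / (1 - s)) • v i) +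
        s • (g i (y0 - a) • v i) := by
      intro i
      rw [smul_smul, smul_smul, ← add_smul]
      congr 1; field_simp; ring
    rw [Finset.sum_congr rfl (fun i _ => e i), Finset.sum_add_distrib, ← Finset.smul_sum,
      ← Finset.smul_sum, ht]
    module
  obtain ⟨x, hx, q, hq, e⟩ := hcov _ hu
  have e' : (x - a) + (q - a) = (2:ℝ) • (∑ i, c i • v i + t • w) := by
    have : (x - a) + (q - a) = (x + q) - (2:ℝ) • a := by module
    rw [this, ← e]; module
  have ef : f (x - a) + f (q - a) = 2 * t := by
    rw [← map_add, e', map_smul, hfsum]; rfl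
  have eg : ∀ i, g i (x - a) + g i (q - a) = 2 * c i := by
    intro i
    rw [← map_add, e', map_smul, hgsum]; rfl
  have hfx : f (x - a) = 0 := by
    by_contra hne
    have h1 := hgap x hx (lt_of_le_of_ne (hf0 x hx) (Ne.symm hne))
    have h2 := hfK q hq
    linarith
  obtain ⟨l, hl, hxl⟩ := (hF x).1 ⟨hx, by rw [map_sub, hfa] at hfx; linarith⟩
  have hgx : ∀ i, g i (x - a) = l i := by
    intro i
    have := hgsum l 0 i
    rw [zero_smul, add_zero] at this
    rw [hxl, add_sub_cancel_left, this]
  have hψq : ψ q = k * η := by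
    have : ∀ i ∈ Finset.univ, (1 - 2 * j i) * (g i (q - a) - j i) = η := by
      intro i _
      have h1 := eg i
      rw [hgx] at h1
      have h2 := hgK i q hq
      rcases hj i with h | h <;> rcases hl i with h' | h' <;> simp only [c, h, h'] at h1 ⊢ <;>
        linarith
    simp only [ψ]
    rw [Finset.sum_congr rfl this]; simp
  have h3 := hψK q hq
  rw [hψq] at h3
  have : f (q - a) = 2 * t := by linarith
  rw [this] at h3
  linarith

theorem cube_of_cover : ∀ (N : ℕ) (S : Finset E), S.card ≤ N → S.Nonempty → Antip S →
    ∀ K : Set E, Convex ℝ K → (∀ x ∈ S, x ∈ K) →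
    (∀ φ : E →ₗ[ℝ] ℝ, ∃ m, ∀ u ∈ K, m ≤ φ u) →
    (∀ u ∈ K, ∃ x ∈ S, ∃ k ∈ K, (2:ℝ) • u = x + k) →
    ∃ (k : ℕ) (a : E) (v : Fin k → E), (∀ i, v i ≠ 0) ∧
      ∀ y, y ∈ S ↔ ∃ c, Corner c ∧ y = a + ∑ i, c i • v i := by
  classical
  intro N
  induction N with
  | zero =>
    intro S h hne
    rw [Nat.le_zero, Finset.card_eq_zero] at h
    subst h; simp at hne
  | succ N ih =>
    intro S hcard hne hS K hK hSK hb hcov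
    by_cases h1 : S.card ≤ 1
    · obtain ⟨a, ha⟩ := hne
      refine ⟨0, a, Fin.elim0, fun i => i.elim0, ?_⟩
      intro y
      constructor
      · intro hy
        exact ⟨Fin.elim0, fun i => i.elim0, by simp [Finset.card_le_one.1 h1 y hy a ha]⟩
      · rintro ⟨c, -, rfl⟩; simpa using ha
    push Not at h1
    obtain ⟨f, r, hr, hex, hgt, hmax⟩ := max_face S hS h1
    let F := S.filter fun x => f x = r
    obtain ⟨k, a, v, hv, hF'⟩ := ih F (by
        have : F ⊂ S := by
          rw [Finset.ssubset_iff_of_subset (Finset.filter_subset _ _)]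
          obtain ⟨x, hx, h⟩ := hgt
          exact ⟨x, hx, by simp [F, h.ne']⟩
        have := Finset.card_lt_card this
        omega)
      (by obtain ⟨x, hx, h⟩ := hex; exact ⟨x, by simp [F, hx, h]⟩)
      (by
        intro x hx y hy hxy
        obtain ⟨φ, h1, h2⟩ := hS x (Finset.mem_filter.1 hx).1 y (Finset.mem_filter.1 hy).1 hxy
        exact ⟨φ, h1, fun z hz => h2 z (Finset.mem_filter.1 hz).1⟩)
      {u | u ∈ K ∧ f u = r}
      (by
        intro x hx y hy s t hs ht hst
        refine ⟨hK hx.1 hy.1 hs ht hst, ?_⟩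
        simp only [map_add, map_smul, hx.2, hy.2, smul_eq_mul]
        rw [← add_mul, hst, one_mul])
      (fun x hx => ⟨hSK x (Finset.mem_filter.1 hx).1, (Finset.mem_filter.1 hx).2⟩)
      (fun φ => by obtain ⟨m, hm⟩ := hb φ; exact ⟨m, fun u hu => hm u hu.1⟩)
      (by
        intro u hu
        obtain ⟨x, hx, q, hq, e⟩ := hcov u hu.1
        have e2 := congrArg f e
        rw [map_smul, map_add, hu.2, smul_eq_mul] at e2
        have hx' := hr x hx
        have hq' := hull_bound S K hb hcov f r hr q hq
        exact ⟨x, Finset.mem_filter.2 ⟨hx, by linarith⟩, q, ⟨hq, by linarith⟩, e⟩)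
    have hF : ∀ y, (y ∈ S ∧ f y = r) ↔ ∃ c, Corner c ∧ y = a + ∑ i, c i • v i := by
      intro y; rw [← hF']; simp [F]
    obtain ⟨hfa, hfv, g, w, hg1, hg2, hg3, hfw, hgw, hrep⟩ :=
      face_coords S hS f r hgt hmax a v hv hF
    have hvert := vertical S f r hr hgt a v hF K hK hSK hb hcov hfa hfv g w hg1 hg2 hg3 hfw hgw hrep
    have hw0 : w ≠ 0 := by rintro rfl; simp at hfw
    have hcS : ∀ c, Corner c → a + ∑ i, c i • v i ∈ S := fun c hc => ((hF _).2 ⟨c, hc, rfl⟩).1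
    -- the separating functional of a vertical edge
    have hsep : ∀ j, Corner j → ∀ τ : ℝ, 0 < τ → a + ∑ i, j i • v i + τ • w ∈ S →
        ∃ φ : E →ₗ[ℝ] ℝ, 0 < φ w ∧ ∀ z ∈ S, φ (a + ∑ i, j i • v i) ≤ φ z ∧
          φ z ≤ φ (a + ∑ i, j i • v i) + τ * φ w := by
      intro j hj τ hτ hmem
      obtain ⟨φ, hlt, hφ⟩ := hS _ hmem _ (hcS j hj) (by simp [hτ.ne', hw0])
      have e : φ (a + ∑ i, j i • v i + τ • w) = φ (a + ∑ i, j i • v i) + τ * φ w := by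
        rw [map_add, map_smul, smul_eq_mul]
      rw [e] at hlt hφ
      exact ⟨φ, by
        have : 0 < τ * φ w := by linarith
        exact pos_of_mul_pos_right this hτ.le, hφ⟩
    have hle : ∀ j, Corner j → ∀ τ : ℝ, 0 < τ → a + ∑ i, j i • v i + τ • w ∈ S →
        ∀ j', Corner j' → ∀ τ' : ℝ, 0 < τ' → a + ∑ i, j' i • v i + τ' • w ∈ S → τ' ≤ τ := by
      intro j hj τ hτ hm j' hj' τ' hτ' hm'
      obtain ⟨φ, hp, hφ⟩ := hsep j hj τ hτ hm
      have h1 := (hφ _ (hcS j' hj')).1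
      have h2 := (hφ _ hm').2
      rw [map_add _ _ (τ' • w), map_smul, smul_eq_mul] at h2
      have : τ' * φ w ≤ τ * φ w := by linarith
      exact le_of_mul_le_mul_right this hp
    have hC0 : Corner (0 : Fin k → ℝ) := fun i => Or.inl rfl
    obtain ⟨τ, hτ, hm⟩ := hvert 0 hC0
    have hall : ∀ j, Corner j → a + ∑ i, j i • v i + τ • w ∈ S := by
      intro j hj
      obtain ⟨τ', hτ', hm'⟩ := hvert j hj
      have : τ' = τ := le_antisymm (hle _ hC0 τ hτ hm _ hj τ' hτ' hm')
        (hle _ hj τ' hτ' hm' _ hC0 τ hτ hm)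
      rwa [← this]
    have hftop : ∀ y ∈ S, f (y - a) ≤ τ := by
      intro y hy
      obtain ⟨φ, hp, hφ⟩ := hsep 0 hC0 τ hτ hm
      simp only [Pi.zero_apply, zero_smul, Finset.sum_const_zero, add_zero] at hφ
      have hφv : ∀ i, 0 ≤ φ (v i) := by
        intro i
        have := (hφ _ (hcS (Pi.single i 1) (by
          intro l; by_cases h : l = i
          · subst h; simp
          · simp [h]))).1
        simpa [Pi.single_apply] using this
      have h2 := (hφ y hy).2
      rw [hrep y hy, map_add, map_add, map_sum, map_smul, smul_eq_mul] at h2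
      have h3 : 0 ≤ ∑ i, φ (g i (y - a) • v i) := Finset.sum_nonneg fun i _ => by
        rw [map_smul, smul_eq_mul]; exact mul_nonneg (hg3 i y hy).1 (hφv i)
      have : f (y - a) * φ w ≤ τ * φ w := by linarith
      exact le_of_mul_le_mul_right this hp
    have hcS' : ∀ c : Fin (k+1) → ℝ, Corner c →
        a + ∑ i, c i • (Fin.snoc v (τ • w) : Fin (k+1) → E) i ∈ S := by
      intro c hc
      rw [Fin.sum_univ_castSucc]
      simp only [Fin.snoc_castSucc, Fin.snoc_last]
      have hc' : Corner (fun i : Fin k => c i.castSucc) := fun i => hc _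
      rw [← add_assoc]
      rcases hc (Fin.last k) with h | h <;> rw [h]
      · simpa using hcS _ hc'
      · simpa using hall _ hc'
    refine ⟨k + 1, a, Fin.snoc v (τ • w), ?_, ?_⟩
    · intro i
      refine Fin.lastCases ?_ (fun i => ?_) i
      · simp [hτ.ne', hw0]
      · simpa using hv i
    · intro y
      constructor
      · intro hy
        refine cube_contain S hS a _ hcS' y hy
          (Fin.snoc (fun i => g i (y - a)) (f (y - a) / τ) : Fin (k+1) → ℝ) ?_ ?_
        · intro i
          refine Fin.lastCases ?_ (fun i => ?_) i
          · simp only [Fin.snoc_last]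
            have : 0 ≤ f (y - a) := by rw [map_sub, hfa]; linarith [hr y hy]
            exact ⟨by positivity, by rw [div_le_one hτ]; exact hftop y hy⟩
          · simpa using hg3 i y hy
        · rw [Fin.sum_univ_castSucc]
          simp only [Fin.snoc_castSucc, Fin.snoc_last]
          rw [smul_smul, div_mul_cancel₀ _ hτ.ne', ← add_assoc]
          exact hrep y hy
      · rintro ⟨c, hc, rfl⟩
        exact hcS' c hc
end cube


section meas
open MeasureTheory Module
variable {E : Type*} [NormedAddCommGroup E] [NormedSpace ℝ E] [FiniteDimensional ℝ E]

lemma exists_open_body (S : Finset E) (hS : Antip S) :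
    ∃ U : Set E, IsOpen U ∧ U.Nonempty ∧ Bornology.IsBounded U ∧ Convex ℝ U ∧
      (∀ x ∈ S, ∀ u ∈ U, ∀ s t : ℝ, 0 < s → 0 < t → s + t = 1 → s • x + t • u ∈ U) ∧
      ∀ x ∈ S, ∀ y ∈ S, x ≠ y → ∃ f : E →ₗ[ℝ] ℝ, ∀ u ∈ U, f y < f u ∧ f u < f x := by
  classical
  have : ∀ x y : E, ∃ f : E →ₗ[ℝ] ℝ, x ∈ S → y ∈ S → x ≠ y →
      f y < f x ∧ ∀ z ∈ S, f y ≤ f z ∧ f z ≤ f x := by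
    intro x y
    by_cases h : x ∈ S ∧ y ∈ S ∧ x ≠ y
    · obtain ⟨f, hf⟩ := hS x h.1 y h.2.1 h.2.2
      exact ⟨f, fun _ _ _ => hf⟩
    · exact ⟨0, fun h1 h2 h3 => absurd ⟨h1, h2, h3⟩ h⟩
  choose F hF using this
  set R : ℝ := 1 + ∑ x ∈ S, ‖x‖ with hR
  have hxR : ∀ x ∈ S, ‖x‖ < R := by
    intro x hx
    have := Finset.single_le_sum (f := fun x : E => ‖x‖) (fun i _ => norm_nonneg i) hx
    linarith
  let U : Set E := ball 0 R ∩ ⋂ x ∈ S, ⋂ y ∈ S,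
    {u | x ≠ y → F x y y < F x y u ∧ F x y u < F x y x}
  have hU : ∀ u, u ∈ U ↔ ‖u‖ < R ∧ ∀ x ∈ S, ∀ y ∈ S, x ≠ y →
      F x y y < F x y u ∧ F x y u < F x y x := by
    intro u; simp [U]
  refine ⟨U, ?_, ?_, ?_, ?_, ?_, ?_⟩
  · refine isOpen_ball.inter (isOpen_biInter_finset fun x _ => isOpen_biInter_finset fun y _ => ?_)
    by_cases h : x = y
    · simp [h]
    · have hc : Continuous (F x y) := LinearMap.continuous_of_finiteDimensional _
      simp only [ne_eq, h, not_false_eq_true, forall_true_left, Set.ofPred_and]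
      exact (isOpen_lt continuous_const hc).inter (isOpen_lt hc continuous_const)
  · refine ⟨(S.card : ℝ)⁻¹ • ∑ x ∈ S, x, (hU _).2 ⟨?_, ?_⟩⟩
    · rw [norm_smul]
      have h1 : ‖(S.card : ℝ)⁻¹‖ ≤ 1 := by
        rw [Real.norm_of_nonneg (by positivity)]; exact Nat.cast_inv_le_one _
      have h2 : ‖∑ x ∈ S, x‖ ≤ ∑ x ∈ S, ‖x‖ := norm_sum_le _ _
      have h3 : ‖(S.card : ℝ)⁻¹‖ * ‖∑ x ∈ S, x‖ ≤ 1 * ∑ x ∈ S, ‖x‖ := by gcongr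
      linarith
    · intro x hx y hy hxy
      obtain ⟨h1, h2⟩ := hF x y hx hy hxy
      have hc : (0:ℝ) < S.card := by exact_mod_cast Finset.card_pos.2 ⟨x, hx⟩
      rw [map_smul, map_sum, smul_eq_mul, lt_inv_mul_iff₀ hc, inv_mul_lt_iff₀ hc]
      constructor
      · rw [← nsmul_eq_mul, ← Finset.sum_const]
        exact Finset.sum_lt_sum (fun z hz => (h2 z hz).1) ⟨x, hx, h1⟩
      · rw [← nsmul_eq_mul, ← Finset.sum_const]
        exact Finset.sum_lt_sum (fun z hz => (h2 z hz).2) ⟨y, hy, h1⟩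
  · exact isBounded_ball.subset Set.inter_subset_left
  · refine (convex_ball _ _).inter (convex_iInter fun x => convex_iInter fun _ =>
      convex_iInter fun y => convex_iInter fun _ => ?_)
    intro u hu w hw s t hs ht hst hxy
    have h1 := hu hxy
    have h2 := hw hxy
    have e : t = 1 - s := by linarith
    subst e
    simp only [map_add, map_smul, smul_eq_mul]
    rcases hs.eq_or_lt with rfl | hs
    · simpa using h2
    · constructor <;> nlinarith
  · intro x hx u hu s t hs ht hst
    obtain ⟨hu1, hu2⟩ := (hU u).1 hu
    refine (hU _).2 ⟨?_, ?_⟩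
    · have := (convex_ball (0:E) R) (mem_ball_zero_iff.2 (hxR x hx)) (mem_ball_zero_iff.2 hu1)
        hs.le ht.le hst
      exact mem_ball_zero_iff.1 this
    · intro a ha b hb hab
      have h1 := (hF a b ha hb hab).2 x hx
      have h2 := hu2 a ha b hb hab
      have e : s = 1 - t := by linarith
      subst e
      simp only [map_add, map_smul, smul_eq_mul]
      constructor <;> nlinarith
  · intro x hx y hy hxy
    exact ⟨F x y, fun u hu => ((hU u).1 hu).2 x hx y hy hxy⟩

theorem antip_card (S : Finset E) (hS : Antip S) :
    S.card ≤ 2 ^ finrank ℝ E ∧ (S.card = 2 ^ finrank ℝ E → ∃ K : Set E, Convex ℝ K ∧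
      (∀ x ∈ S, x ∈ K) ∧ (∀ φ : E →ₗ[ℝ] ℝ, ∃ m, ∀ u ∈ K, m ≤ φ u) ∧
      (∀ u ∈ K, ∃ x ∈ S, ∃ k ∈ K, (2:ℝ) • u = x + k)) := by
  classical
  obtain ⟨U, hUo, ⟨u0, hu0⟩, hUb, hUc, hUx, hUf⟩ := exists_open_body S hS
  let _ : MeasurableSpace E := borel E
  have _ : BorelSpace E := ⟨rfl⟩
  let μ : Measure E := Measure.addHaar
  have hμ0 : μ U ≠ 0 := (hUo.measure_pos μ ⟨u0, hu0⟩).ne'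
  have hμt : μ U ≠ ⊤ := hUb.measure_lt_top.ne
  let A : E → Set E := fun x => AffineMap.homothety x (1/2 : ℝ) '' U
  have hh : ∀ x u : E, AffineMap.homothety x (1/2 : ℝ) u = (1/2 : ℝ) • x + (1/2 : ℝ) • u := by
    intro x u
    rw [AffineMap.homothety_apply, vsub_eq_sub, vadd_eq_add]; module
  have hAU : ∀ x ∈ S, A x ⊆ U := by
    rintro x hx _ ⟨u, hu, rfl⟩
    rw [hh]
    exact hUx x hx u hu _ _ (by norm_num) (by norm_num) (by norm_num)
  have hAo : ∀ x, IsOpen (A x) := by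
    intro x
    exact AffineMap.homothety_isOpenMap x (1/2) (by norm_num) U hUo
  have hdis : (S : Set E).PairwiseDisjoint A := by
    intro x hx y hy hxy
    rw [Function.onFun, Set.disjoint_left]
    rintro _ ⟨u, hu, rfl⟩ ⟨w, hw, e⟩
    obtain ⟨f, hf⟩ := hUf x hx y hy hxy
    rw [hh, hh] at e
    have e2 := congrArg f e
    simp only [map_add, map_smul, smul_eq_mul] at e2
    have := hf u hu
    have := hf w hw
    linarith
  have hμA : ∀ x, μ (A x) = (2 ^ finrank ℝ E)⁻¹ * μ U := by
    intro x
    rw [Measure.addHaar_image_homothety]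
    congr 1
    rw [abs_of_nonneg (by positivity), one_div, inv_pow, ENNReal.ofReal_inv_of_pos (by positivity),
      ENNReal.ofReal_pow (by norm_num)]
    simp
  have hsum : μ (⋃ x ∈ S, A x) = S.card * ((2 ^ finrank ℝ E)⁻¹ * μ U) := by
    rw [measure_biUnion_finset hdis (fun x _ => (hAo x).measurableSet)]
    simp [hμA]
  have hsub : (⋃ x ∈ S, A x) ⊆ U := Set.iUnion₂_subset hAU
  have h2ne : (2 ^ finrank ℝ E : ENNReal) ≠ 0 := by positivity
  have h2nt : (2 ^ finrank ℝ E : ENNReal) ≠ ⊤ := by finiteness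
  refine ⟨?_, ?_⟩
  · have h1 : (S.card : ENNReal) * (2 ^ finrank ℝ E)⁻¹ * μ U ≤ 1 * μ U := by
      rw [mul_assoc, ← hsum, one_mul]; exact measure_mono hsub
    rw [ENNReal.mul_le_mul_iff_left hμ0 hμt, ← div_eq_mul_inv,
      ENNReal.div_le_iff h2ne h2nt, one_mul] at h1
    exact_mod_cast h1
  · intro hcard
    have heq : μ (⋃ x ∈ S, A x) = μ U := by
      rw [hsum, hcard, ← mul_assoc]
      push_cast
      rw [ENNReal.mul_inv_cancel h2ne h2nt, one_mul]
    have hnull : μ (U \ ⋃ x ∈ S, A x) = 0 := by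
      rw [measure_sdiff hsub (S.measurableSet_biUnion fun x _ => (hAo x).measurableSet).nullMeasurableSet
        (by rw [heq]; exact hμt), heq, tsub_self]
    have hclosed : IsClosed (⋃ x ∈ S, closure (A x)) :=
      S.finite_toSet.isClosed_biUnion fun x _ => isClosed_closure
    have hUcov : U ⊆ ⋃ x ∈ S, closure (A x) := by
      have hop : IsOpen (U \ ⋃ x ∈ S, closure (A x)) := hUo.sdiff hclosed
      have hz : μ (U \ ⋃ x ∈ S, closure (A x)) = 0 := by
        refine measure_mono_null (Set.sdiff_subset_sdiff_right ?_) hnull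
        exact Set.iUnion₂_mono fun x _ => subset_closure
      exact Set.sdiff_eq_empty.1 ((hop.measure_eq_zero_iff μ).1 hz)
    refine ⟨closure U, hUc.closure, ?_, ?_, ?_⟩
    · intro x hx
      have h1 : openSegment ℝ x u0 ⊆ U := by
        rintro _ ⟨s, t, hs, ht, hst, rfl⟩
        exact hUx x hx u0 hu0 s t hs ht hst
      have h2 := closure_mono h1
      rw [closure_openSegment] at h2
      exact h2 (left_mem_segment _ _ _)
    · intro φ
      have hc : Continuous φ := LinearMap.continuous_of_finiteDimensional _
      have hcomp : IsCompact (closure U) := hUb.isCompact_closure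
      obtain ⟨m, hm⟩ := (hcomp.image hc).bddBelow
      exact ⟨m, fun u hu => hm ⟨u, hu, rfl⟩⟩
    · intro u hu
      have h1 := closure_minimal hUcov hclosed hu
      simp only [Set.mem_iUnion] at h1
      obtain ⟨x, hx, hu'⟩ := h1
      refine ⟨x, hx, (2:ℝ) • u - x, ?_, by abel⟩
      have hcont : Continuous (fun u : E => (2:ℝ) • u - x) := by fun_prop
      refine map_mem_closure (f := fun u : E => (2:ℝ) • u - x) hcont hu' ?_
      rintro _ ⟨w, hw, rfl⟩
      rw [hh]
      have : (2:ℝ) • ((1/2:ℝ) • x + (1/2:ℝ) • w) - x = w := by module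
      simpa only [this] using hw
end meas


section lpart
open Module

lemma clarkson_scalar (p : ℝ) (hp : 2 ≤ p) (u a : ℝ) :
    2 * (|u| ^ p + |a| ^ p) ≤ |u + a| ^ p + |u - a| ^ p := by
  have hsq : ∀ x : ℝ, |x| ^ p = (x ^ 2) ^ (p / 2) := by
    intro x
    rw [← sq_abs x, ← Real.rpow_natCast, ← Real.rpow_mul (abs_nonneg x)]
    congr 1; push_cast; ring
  have hp1 : 1 ≤ p / 2 := by linarith
  simp only [hsq]
  have h1 : (u ^ 2) ^ (p / 2) + (a ^ 2) ^ (p / 2) ≤ (u ^ 2 + a ^ 2) ^ (p / 2) := by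
    have := NNReal.add_rpow_le_rpow_add (p := p / 2) ⟨u ^ 2, sq_nonneg u⟩ ⟨a ^ 2, sq_nonneg a⟩ hp1
    exact_mod_cast this
  have hcv := (convexOn_rpow hp1).2
  have h2 := hcv (Set.mem_Ici.2 (sq_nonneg (u + a))) (Set.mem_Ici.2 (sq_nonneg (u - a)))
    (by norm_num : (0:ℝ) ≤ 1/2) (by norm_num : (0:ℝ) ≤ 1/2) (by norm_num)
  simp only [smul_eq_mul] at h2
  have e : 1 / 2 * (u + a) ^ 2 + 1 / 2 * (u - a) ^ 2 = u ^ 2 + a ^ 2 := by ring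
  rw [e] at h2
  linarith

variable {n : ℕ} {p : ℝ} [Fact (1 ≤ ENNReal.ofReal p)]

lemma lp_norm_rpow (hp : 2 ≤ p) (x : PiLp (ENNReal.ofReal p) (fun _ : Fin n => ℝ)) :
    ‖x‖ ^ p = ∑ i, |x i| ^ p := by
  have hp0 : 0 < p := by linarith
  have ht : (ENNReal.ofReal p).toReal = p := ENNReal.toReal_ofReal hp0.le
  rw [PiLp.norm_eq_sum (by rw [ht]; exact hp0), ht, ← Real.rpow_mul, one_div,
    inv_mul_cancel₀ hp0.ne', Real.rpow_one]
  · rfl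
  · exact Finset.sum_nonneg fun i _ => by positivity

lemma clarkson_lp (hp : 2 ≤ p) (u a : PiLp (ENNReal.ofReal p) (fun _ : Fin n => ℝ)) :
    2 * (‖u‖ ^ p + ‖a‖ ^ p) ≤ ‖u + a‖ ^ p + ‖u - a‖ ^ p := by
  simp only [lp_norm_rpow hp]
  rw [← Finset.sum_add_distrib, ← Finset.sum_add_distrib, Finset.mul_sum]
  exact Finset.sum_le_sum fun i _ => by simpa using clarkson_scalar p hp (u i) (a i)

lemma cotype (hp : 2 ≤ p) {k : ℕ} (v : Fin k → PiLp (ENNReal.ofReal p) (fun _ : Fin n => ℝ))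
    (T : Finset (Fin k)) : ∀ a, 2 ^ T.card * ∑ i ∈ T, ‖(1/2:ℝ) • v i‖ ^ p ≤
      ∑ J ∈ T.powerset, ‖a + ∑ i ∈ J, v i‖ ^ p := by
  classical
  induction T using Finset.induction_on with
  | empty => intro a; simp; positivity
  | insert i T hi ih =>
    intro a
    rw [Finset.sum_powerset_insert hi, ← Finset.sum_add_distrib, Finset.card_insert_of_notMem hi,
      Finset.sum_insert hi]
    have h1 : ∀ J ∈ T.powerset, 2 * (‖(a + (1/2:ℝ) • v i) + ∑ j ∈ J, v j‖ ^ p +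
        ‖(1/2:ℝ) • v i‖ ^ p) ≤
        ‖a + ∑ j ∈ J, v j‖ ^ p + ‖a + ∑ j ∈ insert i J, v j‖ ^ p := by
      intro J hJ
      have hiJ : i ∉ J := fun h => hi (Finset.mem_powerset.1 hJ h)
      rw [Finset.sum_insert hiJ]
      have := clarkson_lp hp ((a + (1/2:ℝ) • v i) + ∑ j ∈ J, v j) ((1/2:ℝ) • v i)
      have e1 : (a + (1/2:ℝ) • v i) + ∑ j ∈ J, v j + (1/2:ℝ) • v i = a + (v i + ∑ j ∈ J, v j) := by
        module
      have e2 : (a + (1/2:ℝ) • v i) + ∑ j ∈ J, v j - (1/2:ℝ) • v i = a + ∑ j ∈ J, v j := by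
        module
      rw [e1, e2] at this
      linarith
    refine le_trans ?_ (Finset.sum_le_sum h1)
    rw [← Finset.mul_sum, Finset.sum_add_distrib, Finset.sum_const, Finset.card_powerset,
      nsmul_eq_mul]
    have := ih (a + (1/2:ℝ) • v i)
    push_cast
    rw [pow_succ]
    linarith

lemma StrictAntipProp.antip {X : Type*} [NormedAddCommGroup X] [NormedSpace ℝ X] {S : Finset X}
    (h : StrictAntipProp (S : Set X)) : Antip S := by
  intro x hx y hy hxy
  obtain ⟨f, -, h1, h2⟩ := h x hx y hy hxy
  exact ⟨f, by simp; linarith, fun z hz => h2 z hz⟩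

theorem upper (hn : 4 ≤ n) (hp2 : 2 ≤ p) (hplog : p ≤ Real.logb 2 n)
    (S : Finset (PiLp (ENNReal.ofReal p) (fun _ : Fin n => ℝ)))
    (hsph : (S : Set (PiLp (ENNReal.ofReal p) (fun _ : Fin n => ℝ))) ⊆ sphere 0 1)
    (hS : StrictAntipProp (S : Set (PiLp (ENNReal.ofReal p) (fun _ : Fin n => ℝ)))) :
    S.card < 2 ^ n := by
  classical
  have hfr : finrank ℝ (PiLp (ENNReal.ofReal p) (fun _ : Fin n => ℝ)) = n := by
    rw [LinearEquiv.finrank_eq (WithLp.linearEquiv _ ℝ _)]; simp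
  obtain ⟨h1, h2⟩ := antip_card S hS.antip
  rw [hfr] at h1 h2
  refine lt_of_le_of_ne h1 fun hcard => ?_
  obtain ⟨K, hK, hSK, hb, hcov⟩ := h2 hcard
  obtain ⟨k, a, v, hv, hcube⟩ := cube_of_cover S.card S le_rfl
    (Finset.card_pos.1 (by rw [hcard]; positivity)) hS.antip K hK hSK hb hcov
  have hJ : ∀ J : Finset (Fin k), a + ∑ i ∈ J, v i ∈ S := by
    intro J
    refine (hcube _).2 ⟨fun i => if i ∈ J then 1 else 0, ?_, ?_⟩
    · intro i; by_cases h : i ∈ J <;> simp [h]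
    · simp [Finset.sum_ite_mem]
  have hkn : n ≤ k := by
    have hsub : S ⊆ (Finset.univ : Finset (Fin k)).powerset.image fun J => a + ∑ i ∈ J, v i := by
      intro y hy
      obtain ⟨c, hc, rfl⟩ := (hcube y).1 hy
      refine Finset.mem_image.2 ⟨Finset.univ.filter fun i => c i = 1, by simp, ?_⟩
      rw [Finset.sum_filter]
      congr 1
      refine Finset.sum_congr rfl fun i _ => ?_
      rcases hc i with h | h <;> simp [h]
    have := (Finset.card_le_card hsub).trans Finset.card_image_le
    rw [hcard, Finset.card_powerset, Finset.card_univ, Fintype.card_fin] at this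
    exact (Nat.pow_le_pow_iff_right (by norm_num)).1 this
  have hvn : ∀ i, 1 < ‖v i‖ := by
    intro i
    have ha : a ∈ S := by simpa using hJ ∅
    have hai : a + v i ∈ S := by simpa using hJ {i}
    obtain ⟨f, hf, hgap, -⟩ := hS _ hai a ha (by simpa using hv i)
    rw [map_add, add_sub_cancel_left] at hgap
    calc 1 < f (v i) := hgap
      _ ≤ ‖f (v i)‖ := le_abs_self _
      _ ≤ ‖f‖ * ‖v i‖ := f.le_opNorm _
      _ ≤ 1 * ‖v i‖ := by gcongr
      _ = ‖v i‖ := one_mul _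
  have hc := cotype hp2 v Finset.univ a
  have hn1 : ∀ J ∈ (Finset.univ : Finset (Fin k)).powerset, ‖a + ∑ i ∈ J, v i‖ ^ p = 1 := by
    intro J _
    rw [mem_sphere_zero_iff_norm.1 (hsph (hJ J)), Real.one_rpow]
  rw [Finset.sum_congr rfl hn1, Finset.sum_const, Finset.card_powerset, nsmul_eq_mul, mul_one] at hc
  push_cast at hc
  have hc1 : ∑ i, ‖(1/2:ℝ) • v i‖ ^ p ≤ 1 := by
    have : (0:ℝ) < 2 ^ (Finset.univ : Finset (Fin k)).card := by positivity
    nlinarith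
  have h2p : (2:ℝ) ^ p ≤ n := (Real.le_logb_iff_rpow_le (by norm_num) (by positivity)).1 hplog
  have hgt : ∑ _i : Fin k, ((2:ℝ) ^ p)⁻¹ < ∑ i, ‖(1/2:ℝ) • v i‖ ^ p := by
    have : Nonempty (Fin k) := ⟨⟨0, by omega⟩⟩
    refine Finset.sum_lt_sum_of_nonempty Finset.univ_nonempty fun i _ => ?_
    rw [← Real.inv_rpow (by norm_num)]
    refine Real.rpow_lt_rpow (by norm_num) ?_ (by linarith)
    rw [norm_smul]
    have := hvn i
    norm_num
    linarith
  rw [Finset.sum_const, Finset.card_univ, Fintype.card_fin, nsmul_eq_mul] at hgt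
  have hpos : (0:ℝ) < 2 ^ p := by positivity
  have : 1 ≤ (k:ℝ) * ((2:ℝ) ^ p)⁻¹ := by
    rw [← div_eq_mul_inv, one_le_div hpos]
    exact h2p.trans (by exact_mod_cast hkn)
  linarith

/-! lower bound -/

def sg (b : Bool) : ℝ := if b then 1 else -1

lemma sg_abs (b : Bool) : |sg b| = 1 := by cases b <;> simp [sg]
lemma sg_mul_self (b : Bool) : sg b * sg b = 1 := by cases b <;> simp [sg]
lemma sg_mul_ne {b c : Bool} (h : b ≠ c) : sg b * sg c = -1 := by
  cases b <;> cases c <;> simp [sg] at h ⊢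
lemma sg_mul_bd (b c : Bool) : -1 ≤ sg b * sg c ∧ sg b * sg c ≤ 1 := by
  cases b <;> cases c <;> simp [sg]

def pt (p α β : ℝ) {m : ℕ} (q : Fin m × Bool × Bool) :
    PiLp (ENNReal.ofReal p) (fun _ : Fin (m+1) => ℝ) :=
  WithLp.toLp _ (Fin.snoc (Pi.single q.1 (sg q.2.1 * α)) (sg q.2.2 * β) : Fin (m+1) → ℝ)

lemma pt_cast (p α β : ℝ) {m : ℕ} (q : Fin m × Bool × Bool) (l : Fin m) :
    pt p α β q l.castSucc = if l = q.1 then sg q.2.1 * α else 0 := by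
  simp [pt, Pi.single_apply]

lemma pt_last (p α β : ℝ) {m : ℕ} (q : Fin m × Bool × Bool) :
    pt p α β q (Fin.last m) = sg q.2.2 * β := by
  simp [pt]

lemma coord_fun (i : Fin n) (s : ℝ) (hs : |s| = 1) :
    ∃ f : PiLp (ENNReal.ofReal p) (fun _ : Fin n => ℝ) →L[ℝ] ℝ, ‖f‖ ≤ 1 ∧ ∀ u, f u = s * u i := by
  refine ⟨s • PiLp.proj _ (fun _ : Fin n => ℝ) i, ?_, fun u => by simp⟩
  refine ContinuousLinearMap.opNorm_le_bound _ zero_le_one fun u => ?_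
  have := PiLp.norm_apply_le u i
  simpa [abs_mul, hs] using this

lemma diff_fun (hp : 2 ≤ p) (i j : Fin n) (hij : i ≠ j) (s t : ℝ) (hs : |s| = 1) (ht : |t| = 1) :
    ∃ f : PiLp (ENNReal.ofReal p) (fun _ : Fin n => ℝ) →L[ℝ] ℝ, ‖f‖ ≤ 1 ∧
      ∀ u, f u = (2:ℝ) ^ (1 / p) / 2 * (s * u i - t * u j) := by
  have hp0 : 0 < p := by linarith
  refine ⟨((2:ℝ) ^ (1 / p) / 2) • (s • PiLp.proj _ (fun _ : Fin n => ℝ) i -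
    t • PiLp.proj _ (fun _ : Fin n => ℝ) j), ?_, fun u => by simp⟩
  refine ContinuousLinearMap.opNorm_le_bound _ zero_le_one fun u => ?_
  have e : (((2:ℝ) ^ (1 / p) / 2) • (s • PiLp.proj (ENNReal.ofReal p) (fun _ : Fin n => ℝ) i -
    t • PiLp.proj (ENNReal.ofReal p) (fun _ : Fin n => ℝ) j) :
      PiLp (ENNReal.ofReal p) (fun _ : Fin n => ℝ) →L[ℝ] ℝ) u =
      (2:ℝ) ^ (1 / p) / 2 * (s * u i - t * u j) := by simp
  rw [e, one_mul, Real.norm_eq_abs, abs_mul, abs_of_pos (by positivity)]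
  have h1 : |s * u i - t * u j| ≤ |u i| + |u j| := by
    refine (abs_sub _ _).trans ?_
    rw [abs_mul, abs_mul, hs, ht, one_mul, one_mul]
  have h2 : (2:ℝ) ^ (1 / p) / 2 * |s * u i - t * u j| ≤
      (2:ℝ) ^ (1 / p) * (1/2 * |u i| + 1/2 * |u j|) := by
    have : (0:ℝ) < (2:ℝ) ^ (1 / p) := by positivity
    nlinarith
  refine h2.trans ?_
  rw [← Real.rpow_le_rpow_iff (by positivity) (norm_nonneg u) hp0, lp_norm_rpow hp,
    Real.mul_rpow (by positivity) (by positivity), ← Real.rpow_mul (by norm_num), one_div,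
    inv_mul_cancel₀ hp0.ne', Real.rpow_one]
  have hcv := (convexOn_rpow (p := p) (by linarith)).2
  have h3 := hcv (Set.mem_Ici.2 (abs_nonneg (u i))) (Set.mem_Ici.2 (abs_nonneg (u j)))
    (by norm_num : (0:ℝ) ≤ 1/2) (by norm_num : (0:ℝ) ≤ 1/2) (by norm_num)
  simp only [smul_eq_mul] at h3
  have h4 : |u i| ^ p + |u j| ^ p ≤ ∑ l, |u l| ^ p := by
    rw [← Finset.sum_pair (f := fun l => |u l| ^ p) hij]
    exact Finset.sum_le_sum_of_subset_of_nonneg (Finset.subset_univ _)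
      fun l _ _ => by positivity
  linarith

lemma one_lt_of_rpow {x p : ℝ} (hx : 0 ≤ x) (hp : 0 ≤ p) (h : 1 < x ^ p) : 1 < x := by
  by_contra hle
  exact absurd h (not_lt.2 (Real.rpow_le_one hx (not_lt.1 hle) hp))

theorem lower (hn : 4 ≤ n) (hp : 2 ≤ p) :
    ∃ S : Finset (PiLp (ENNReal.ofReal p) (fun _ : Fin n => ℝ)), S.card = 4 * n - 4 ∧
      (S : Set (PiLp (ENNReal.ofReal p) (fun _ : Fin n => ℝ))) ⊆ sphere 0 1 ∧
      StrictAntipProp (S : Set (PiLp (ENNReal.ofReal p) (fun _ : Fin n => ℝ))) := by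
  classical
  obtain ⟨m, rfl⟩ : ∃ m, n = m + 1 := ⟨n - 1, by omega⟩
  have hp0 : 0 < p := by linarith
  have hinv : ∀ x : ℝ, 0 ≤ x → (x ^ (1 / p)) ^ p = x := by
    intro x hx
    rw [← Real.rpow_mul hx, one_div, inv_mul_cancel₀ hp0.ne', Real.rpow_one]
  obtain ⟨α, hα0, hαp⟩ : ∃ α : ℝ, 0 < α ∧ α ^ p = 2/3 :=
    ⟨(2/3) ^ (1/p), by positivity, hinv _ (by norm_num)⟩
  obtain ⟨β, hβ0, hβp⟩ : ∃ β : ℝ, 0 < β ∧ β ^ p = 1/3 :=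
    ⟨(1/3) ^ (1/p), by positivity, hinv _ (by norm_num)⟩
  have h2p : (4:ℝ) ≤ 2 ^ p := by
    have : (2:ℝ) ^ (2:ℝ) ≤ 2 ^ p := Real.rpow_le_rpow_of_exponent_le (by norm_num) hp
    norm_num at this; exact this
  have hα2 : 1 < 2 * α := by
    apply one_lt_of_rpow (by positivity) hp0.le
    rw [Real.mul_rpow (by norm_num) hα0.le, hαp]; linarith
  have hβ2 : 1 < 2 * β := by
    apply one_lt_of_rpow (by positivity) hp0.le
    rw [Real.mul_rpow (by norm_num) hβ0.le, hβp]; linarith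
  have hα3 : 1 < (2:ℝ) ^ (1/p) * α := by
    apply one_lt_of_rpow (by positivity) hp0.le
    rw [Real.mul_rpow (by positivity) hα0.le, hαp, hinv _ (by norm_num)]; norm_num
  -- separation of indices
  have hsep : ∀ x y : Fin m × Bool × Bool, x ≠ y →
      ∃ f : PiLp (ENNReal.ofReal p) (fun _ : Fin (m+1) => ℝ) →L[ℝ] ℝ, ‖f‖ ≤ 1 ∧
        1 < f (pt p α β x) - f (pt p α β y) ∧
        ∀ z, f (pt p α β y) ≤ f (pt p α β z) ∧ f (pt p α β z) ≤ f (pt p α β x) := by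
    rintro ⟨i, s, t⟩ ⟨i', s', t'⟩ hne
    by_cases ht : t = t'
    · subst ht
      by_cases hi : i = i'
      · subst hi
        have hs : s ≠ s' := by rintro rfl; exact hne rfl
        obtain ⟨f, hf, hfu⟩ := coord_fun (p := p) (i.castSucc) (sg s) (sg_abs s)
        refine ⟨f, hf, ?_, ?_⟩
        · simp only [hfu, pt_cast, if_true]
          have := sg_mul_self s
          have := sg_mul_ne hs
          nlinarith
        · rintro ⟨l, a, b⟩
          simp only [hfu, pt_cast, if_true]
          rw [← mul_assoc, ← mul_assoc, sg_mul_self, sg_mul_ne hs]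
          have := sg_mul_bd s a
          split_ifs
          · rw [← mul_assoc]; constructor <;> nlinarith
          · constructor <;> linarith
      · obtain ⟨f, hf, hfu⟩ := diff_fun hp (i.castSucc) (i'.castSucc)
          (fun h => hi (Fin.castSucc_injective _ h)) (sg s) (sg s') (sg_abs s) (sg_abs s')
        have hC : (0:ℝ) < (2:ℝ) ^ (1/p) / 2 := by positivity
        have hi' : ¬ i' = i := fun h => hi h.symm
        have e1 : f (pt p α β (i, s, t)) = (2:ℝ) ^ (1/p) / 2 * α := by
          simp only [hfu, pt_cast, if_true, if_neg hi']
          rw [← mul_assoc (sg s), sg_mul_self]; ring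
        have e2 : f (pt p α β (i', s', t)) = (2:ℝ) ^ (1/p) / 2 * (-α) := by
          simp only [hfu, pt_cast, if_true, if_neg hi]
          rw [← mul_assoc (sg s'), sg_mul_self]; ring
        refine ⟨f, hf, ?_, ?_⟩
        · rw [e1, e2]; linarith
        · rintro ⟨l, a, b⟩
          rw [e1, e2]
          simp only [hfu, pt_cast]
          have h1 := sg_mul_bd s a
          have h2 := sg_mul_bd s' a
          constructor
          · apply mul_le_mul_of_nonneg_left _ hC.le
            split_ifs with h3 h4
            · exact absurd (h3.trans h4.symm) hi
            · nlinarith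
            · nlinarith
            · nlinarith
          · apply mul_le_mul_of_nonneg_left _ hC.le
            split_ifs with h3 h4
            · exact absurd (h3.trans h4.symm) hi
            · nlinarith
            · nlinarith
            · nlinarith
    · obtain ⟨f, hf, hfu⟩ := coord_fun (p := p) (Fin.last m) (sg t) (sg_abs t)
      refine ⟨f, hf, ?_, ?_⟩
      · simp only [hfu, pt_last]
        have := sg_mul_self t
        have := sg_mul_ne ht
        nlinarith
      · rintro ⟨l, a, b⟩
        simp only [hfu, pt_last]
        rw [← mul_assoc, ← mul_assoc, ← mul_assoc, sg_mul_self, sg_mul_ne ht]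
        have := sg_mul_bd t b
        constructor <;> nlinarith
  have hinj : Function.Injective (pt p α β (m := m)) := by
    intro x y hxy
    by_contra hne
    obtain ⟨f, -, h, -⟩ := hsep x y hne
    rw [hxy] at h
    linarith
  refine ⟨Finset.univ.image (pt p α β (m := m)), ?_, ?_, ?_⟩
  · rw [Finset.card_image_of_injective _ hinj]
    simp
    omega
  · intro x hx
    simp only [Finset.coe_image, Finset.coe_univ, Set.image_univ, Set.mem_range] at hx
    obtain ⟨q, rfl⟩ := hx
    rw [mem_sphere_zero_iff_norm]
    have h1 : ‖pt p α β q‖ ^ p = 1 := by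
      rw [lp_norm_rpow hp, Fin.sum_univ_castSucc, pt_last, Finset.sum_eq_single q.1]
      · rw [pt_cast, if_pos rfl, abs_mul, abs_mul, sg_abs, sg_abs, one_mul, one_mul,
          abs_of_pos hα0, abs_of_pos hβ0, hαp, hβp]
        norm_num
      · intro l _ hl
        rw [pt_cast, if_neg hl, abs_zero, Real.zero_rpow hp0.ne']
      · simp
    have h2 := congrArg (fun t : ℝ => t ^ (1 / p)) h1
    simp only [Real.one_rpow] at h2
    rwa [← Real.rpow_mul (norm_nonneg _), mul_one_div_cancel hp0.ne', Real.rpow_one] at h2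
  · intro x hx y hy hxy
    simp only [Finset.coe_image, Finset.coe_univ, Set.image_univ, Set.mem_range] at hx hy
    obtain ⟨q, rfl⟩ := hx
    obtain ⟨q', rfl⟩ := hy
    obtain ⟨f, hf, h1, h2⟩ := hsep q q' (fun h => hxy (by rw [h]))
    refine ⟨f, hf, h1, ?_⟩
    intro z hz
    simp only [Finset.coe_image, Finset.coe_univ, Set.image_univ, Set.mem_range] at hz
    obtain ⟨q'', rfl⟩ := hz
    exact h2 q''
end lpart

theorem strictHalpha_lp_lt_of_le_logb (n : ℕ) (hn : 4 ≤ n) (p : ℝ) (hp2 : 2 ≤ p)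
    (hplog : p ≤ Real.logb 2 n) [Fact (1 ≤ ENNReal.ofReal p)] :
    4 * n - 4 ≤ strictHalpha (PiLp (ENNReal.ofReal p) (fun _ : Fin n => ℝ)) ∧
    strictHalpha (PiLp (ENNReal.ofReal p) (fun _ : Fin n => ℝ)) < 2 ^ n ∧
    ¬ ∃ S : Finset (PiLp (ENNReal.ofReal p) (fun _ : Fin n => ℝ)),
        S.card = 2 ^ n ∧
        (S : Set (PiLp (ENNReal.ofReal p) (fun _ : Fin n => ℝ))) ⊆ sphere 0 1 ∧
        ∃ d : ℝ, 1 < d ∧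
          IsBSA (S : Set (PiLp (ENNReal.ofReal p) (fun _ : Fin n => ℝ))) d := by
  obtain ⟨S0, hS0, hs0, ha0⟩ := lower (n := n) (p := p) hn hp2
  have hub : ∀ k ∈ {k : ℕ | ∃ S : Finset (PiLp (ENNReal.ofReal p) (fun _ : Fin n => ℝ)),
      S.card = k ∧ (S : Set (PiLp (ENNReal.ofReal p) (fun _ : Fin n => ℝ))) ⊆ sphere 0 1 ∧
      StrictAntipProp (S : Set (PiLp (ENNReal.ofReal p) (fun _ : Fin n => ℝ)))},
      k < 2 ^ n := by
    rintro k ⟨S, rfl, hs, ha⟩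
    exact upper hn hp2 hplog S hs ha
  refine ⟨?_, ?_, ?_⟩
  · exact le_csSup ⟨2 ^ n, fun k hk => (hub k hk).le⟩ ⟨S0, hS0, hs0, ha0⟩
  · exact hub _ (Nat.sSup_mem ⟨_, S0, hS0, hs0, ha0⟩ ⟨2 ^ n, fun k hk => (hub k hk).le⟩)
  · rintro ⟨S, hcard, hs, d, hd, -, h⟩
    refine (upper hn hp2 hplog S hs ?_).ne hcard
    intro x hx y hy hxy
    obtain ⟨f, hf, h1, h2⟩ := h x hx y hy hxy
    exact ⟨f, hf, by linarith, h2⟩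

end
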